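/- Let Ω ⊆ ℝ^d be a bounded open set with smooth boundary, T > 0, ε > 0 and A > 0. Let f = (f₁,…,f_d) with each f_j ∈ C²(ℝ) and f_j′ bounded, and let B ∈ C¹(ℝ) be bounded with B ≥ 0. Let (δ_n) be a sequence of positive reals with δ_n → 0, for each n let u_n be a classical solution of the regularized viscosity problem with flux f, viscosity coefficient B + δ_n, parameter ε and data u_{0,n} ∈ C_c^∞(Ω) with ‖u_{0,n}‖_{L^∞(Ω)} ≤ A, and suppose u_n → u almost everywhere in Ω_T. Then for every v ∈ C_c^∞(Ω_T) the limit L(v) := lim_{n→∞} Σ_{j=1}^d ∫_{Ω_T} B(u_n) ∂_{x_j}u_n ∂_{x_j}v dx dt exists, and ∫_{Ω_T} u ∂_t v dx dt + Σ_{j=1}^d ∫_{Ω_T} f_j(u) ∂_{x_j}v dx dt = ε L(v). -/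

import Mathlib

open MeasureTheory Set

noncomputable section

/-- The spatial partial derivative of `v` in the `j`-th coordinate direction. -/
def pderiv' {d : ℕ} (v : (Fin d → ℝ) → ℝ) (j : Fin d) (x : Fin d → ℝ) : ℝ :=
  fderiv ℝ v x (Pi.single j 1)

/-- A classical solution of the regularized viscosity problem
`∂ₜ u + Σⱼ ∂ⱼ(fⱼ(u)) = ε Σⱼ ∂ⱼ((B(u)+δ) ∂ⱼ u)` on `Ω × (0,T)`, with homogeneous
Dirichlet boundary condition on `∂Ω × (0,T)` and initial data `u₀`. -/
structure IsClassicalSolution {d : ℕ} (Ω : Set (Fin d → ℝ)) (T ε δ : ℝ)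
    (f : Fin d → ℝ → ℝ) (B : ℝ → ℝ) (u₀ : (Fin d → ℝ) → ℝ)
    (u : (Fin d → ℝ) → ℝ → ℝ) : Prop where
  cont : ContinuousOn (fun p : (Fin d → ℝ) × ℝ => u p.1 p.2) (closure Ω ×ˢ Set.Icc 0 T)
  diff_t : ∀ x ∈ Ω, ∀ t ∈ Set.Ioo 0 T, DifferentiableAt ℝ (u x) t
  diff_x : ∀ x ∈ Ω, ∀ t ∈ Set.Ioo 0 T, DifferentiableAt ℝ (fun y => u y t) x
  diff_xx : ∀ j, ∀ x ∈ Ω, ∀ t ∈ Set.Ioo 0 T,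
      DifferentiableAt ℝ (fun y => pderiv' (fun z => u z t) j y) x
  cont_dt : ContinuousOn (fun p : (Fin d → ℝ) × ℝ => deriv (u p.1) p.2) (Ω ×ˢ Set.Ioo 0 T)
  cont_dx : ∀ j, ContinuousOn
      (fun p : (Fin d → ℝ) × ℝ => pderiv' (fun y => u y p.2) j p.1) (Ω ×ˢ Set.Ioo 0 T)
  cont_dxx : ∀ i j, ContinuousOn
      (fun p : (Fin d → ℝ) × ℝ => pderiv' (pderiv' (fun y => u y p.2) j) i p.1)
      (Ω ×ˢ Set.Ioo 0 T)
  pde : ∀ x ∈ Ω, ∀ t ∈ Set.Ioo 0 T,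
      deriv (u x) t + ∑ j, pderiv' (fun y => f j (u y t)) j x
        = ε * ∑ j, pderiv' (fun y => (B (u y t) + δ) * pderiv' (fun z => u z t) j y) j x
  bc : ∀ x ∈ frontier Ω, ∀ t ∈ Set.Ioo 0 T, u x t = 0
  ic : ∀ x ∈ Ω, u x 0 = u₀ x

open Filter Topology

section IntegrationByParts

variable {E : Type*} [NormedAddCommGroup E]

/-- A function continuous on an open set times a continuous function supported in that set is
continuous. -/
theorem continuous_mul_of_tsupport_subset {S : Set E} (hS : IsOpen S) {F g : E → ℝ}
    (hF : ContinuousOn F S) (hg : Continuous g) (hgS : tsupport g ⊆ S) :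
    Continuous (fun p => F p * g p) :=
  ContinuousOn.continuous_of_tsupport_subset (hF.mul hg.continuousOn) hS
    ((tsupport_mul_subset_right (f := F) (g := g)).trans hgS)

theorem tsupport_fderiv_apply_subset_of_subset [NormedSpace ℝ E] {S : Set E} {v : E → ℝ} (hvS : tsupport v ⊆ S)
    (e : E) : tsupport (fun p => fderiv ℝ v p e) ⊆ S :=
  (tsupport_fderiv_apply_subset ℝ e).trans hvS

variable [MeasurableSpace E] [BorelSpace E] {μ : Measure E}

theorem integrable_mul_of_tsupport_subset [IsFiniteMeasureOnCompacts μ] {S : Set E}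
    (hS : IsOpen S) {F g : E → ℝ} (hF : ContinuousOn F S) (hg : Continuous g) (hgc : HasCompactSupport g)
    (hgS : tsupport g ⊆ S) : Integrable (fun p => F p * g p) μ :=
  (continuous_mul_of_tsupport_subset hS hF hg hgS).integrable_of_hasCompactSupport hgc.mul_left

/-- Integration by parts on an open set against a compactly supported test function, for a function
that has a continuous line derivative. -/
theorem setIntegral_mul_fderiv_eq_neg_of_hasLineDerivAt [NormedSpace ℝ E]
    [FiniteDimensional ℝ E] [μ.IsAddHaarMeasure] {S : Set E} (hS : IsOpen S)
    {F F' v : E → ℝ} {e : E} (hF : ContinuousOn F S) (hF' : ContinuousOn F' S)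
    (hd : ∀ p ∈ S, HasLineDerivAt ℝ F (F' p) p e) (hv : ContDiff ℝ 1 v)
    (hvc : HasCompactSupport v) (hvS : tsupport v ⊆ S) :
    ∫ p in S, F p * fderiv ℝ v p e ∂μ = -∫ p in S, F' p * v p ∂μ := by
  have hv'c : Continuous (fun p => fderiv ℝ v p e) :=
    (hv.continuous_fderiv one_ne_zero).clm_apply continuous_const
  have hv'S := tsupport_fderiv_apply_subset_of_subset hvS e
  have hv0 : ∀ p, p ∉ S → v p = 0 := fun p hp =>
    image_eq_zero_of_notMem_tsupport fun h => hp (hvS h)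
  have hv'0 : ∀ p, p ∉ S → fderiv ℝ v p e = 0 := fun p hp =>
    image_eq_zero_of_notMem_tsupport (f := fun p => fderiv ℝ v p e) fun h => hp (hv'S h)
  rw [setIntegral_eq_integral_of_forall_compl_eq_zero fun p hp => by rw [hv'0 p hp, mul_zero],
    setIntegral_eq_integral_of_forall_compl_eq_zero fun p hp => by rw [hv0 p hp, mul_zero]]
  exact integral_bilinear_hasLineDerivAt_right_eq_neg_left_of_integrable
    (B := ContinuousLinearMap.mul ℝ ℝ)
    (integrable_mul_of_tsupport_subset hS hF' hv.continuous hvc hvS)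
    (integrable_mul_of_tsupport_subset hS hF hv'c (hvc.fderiv_apply ℝ e) hv'S)
    (integrable_mul_of_tsupport_subset hS hF hv.continuous hvc hvS)
    (fun p hp => hd p (hvS hp))
    (fun p _ => ((hv.differentiable one_ne_zero) p).hasFDerivAt.hasLineDerivAt e)

end IntegrationByParts

instance {d : ℕ} : (volume : Measure ((Fin d → ℝ) × ℝ)).IsAddHaarMeasure :=
  inferInstanceAs
    ((volume : Measure (Fin d → ℝ)).prod (volume : Measure ℝ)).IsAddHaarMeasure

section MaximumPrinciple

/-- The second derivative is nonpositive at a local maximum. -/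
theorem IsLocalMax.deriv_deriv_nonpos {g : ℝ → ℝ} {a : ℝ} (h : IsLocalMax g a)
    (hc : ContinuousAt g a) : deriv (deriv g) a ≤ 0 := by
  by_contra! hpos
  have hmin := isLocalMin_of_deriv_deriv_pos hpos h.deriv_eq_zero hc
  have heq : g =ᶠ[𝓝 a] fun _ => g a := by
    filter_upwards [h, hmin] with x h1 h2 using le_antisymm h1 h2
  have : deriv (deriv g) a = 0 := by
    rw [heq.deriv.deriv_eq]
    simp
  exact hpos.ne' this

/-- A pure second partial derivative is nonpositive at a local maximum. -/
theorem IsLocalMax.pderiv'_pderiv'_nonpos {d : ℕ} {w : (Fin d → ℝ) → ℝ} {x : Fin d → ℝ}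
    (h : IsLocalMax w x) (hd : ∀ᶠ y in 𝓝 x, DifferentiableAt ℝ w y) (j : Fin d)
    (hdd : DifferentiableAt ℝ (pderiv' w j) x) : pderiv' (pderiv' w j) j x ≤ 0 := by
  set e : Fin d → ℝ := Pi.single j 1 with he
  have hline : ∀ s : ℝ, HasDerivAt (fun s : ℝ => x + s • e) e s := fun s => by
    simpa using ((hasDerivAt_id s).smul_const e).const_add x
  have htend : Tendsto (fun s : ℝ => x + s • e) (𝓝 0) (𝓝 x) := by
    simpa using (hline 0).continuousAt.tendsto
  have hmax : IsLocalMax (fun s : ℝ => w (x + s • e)) 0 := by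
    filter_upwards [htend.eventually h] with s hs
    simpa using hs
  have h1 : deriv (fun s : ℝ => w (x + s • e)) =ᶠ[𝓝 0] fun s => pderiv' w j (x + s • e) := by
    filter_upwards [htend.eventually hd] with s hs
    exact (hs.hasFDerivAt.comp_hasDerivAt s (hline s)).deriv
  have h2 : deriv (fun s : ℝ => pderiv' w j (x + s • e)) 0 = pderiv' (pderiv' w j) j x := by
    have hdd' : HasFDerivAt (pderiv' w j) (fderiv ℝ (pderiv' w j) x) (x + (0 : ℝ) • e) := by
      simpa using hdd.hasFDerivAt
    exact (hdd'.comp_hasDerivAt (0 : ℝ) (hline 0)).deriv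
  have hcont : ContinuousAt (fun s : ℝ => w (x + s • e)) 0 :=
    ContinuousAt.comp (g := w) (by simpa using hd.self_of_nhds.continuousAt)
      (hline 0).continuousAt
  have := hmax.deriv_deriv_nonpos hcont
  rwa [h1.deriv_eq, h2] at this

/-- A weak parabolic maximum principle: if the time derivative is nonpositive wherever the spatial
slice has a local maximum, then the function is bounded by its values on the parabolic boundary. -/
theorem le_of_deriv_nonpos_of_isLocalMax {d : ℕ} {Ω : Set (Fin d → ℝ)} (hΩ : IsOpen Ω)
    (hΩbd : Bornology.IsBounded Ω) {T A : ℝ} {w : (Fin d → ℝ) → ℝ → ℝ}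
    (hc : ContinuousOn (fun p : (Fin d → ℝ) × ℝ => w p.1 p.2) (closure Ω ×ˢ Icc 0 T))
    (hdt : ∀ x ∈ Ω, ∀ t ∈ Ioo 0 T, DifferentiableAt ℝ (w x) t)
    (hcrit : ∀ x ∈ Ω, ∀ t ∈ Ioo 0 T, IsLocalMax (fun y => w y t) x → deriv (w x) t ≤ 0)
    (hbc : ∀ x ∈ frontier Ω, ∀ t ∈ Ioo 0 T, w x t ≤ A) (hic : ∀ x ∈ Ω, w x 0 ≤ A)
    {x₀ : Fin d → ℝ} (hx₀ : x₀ ∈ Ω) {t₀ : ℝ} (ht₀ : t₀ ∈ Ioo 0 T) : w x₀ t₀ ≤ A := by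
  by_contra! hlt
  obtain ⟨ht0, htT⟩ := ht₀
  obtain ⟨η, hη, hηlt⟩ : ∃ η > 0, η * t₀ < w x₀ t₀ - A := by
    refine ⟨(w x₀ t₀ - A) / (2 * t₀), by have := sub_pos.2 hlt; positivity, ?_⟩
    have : (w x₀ t₀ - A) / (2 * t₀) * t₀ = (w x₀ t₀ - A) / 2 := by field_simp
    rw [this]
    linarith
  have hK : IsCompact (closure Ω ×ˢ Icc 0 t₀) := hΩbd.isCompact_closure.prod isCompact_Icc
  have hφ : ContinuousOn (fun p : (Fin d → ℝ) × ℝ => w p.1 p.2 - η * p.2)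
      (closure Ω ×ˢ Icc 0 t₀) :=
    (hc.mono (prod_mono_right (Icc_subset_Icc_right htT.le))).sub (by fun_prop)
  have hmem : (x₀, t₀) ∈ closure Ω ×ˢ Icc 0 t₀ :=
    ⟨subset_closure hx₀, ht0.le, le_rfl⟩
  obtain ⟨⟨x, t⟩, ⟨hx, ht⟩, hmax⟩ := hK.exists_isMaxOn ⟨_, hmem⟩ hφ
  rw [isMaxOn_iff] at hmax
  simp only at hx ht hmax
  have hgt : A < w x t - η * t := by
    have := hmax _ hmem
    simp only at this
    linarith
  have hηt : 0 ≤ η * t := mul_nonneg hη.le ht.1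
  rcases ht.1.eq_or_lt with rfl | htpos
  · have hle : w x 0 ≤ A := le_on_closure (f := fun y => w y 0) (g := fun _ => A) hic
      (hc.comp (f := fun y => (y, (0 : ℝ))) (by fun_prop)
        fun y hy => ⟨hy, le_rfl, (ht0.trans htT).le⟩)
      continuousOn_const hx
    linarith
  have htI : t ∈ Ioo 0 T := ⟨htpos, ht.2.trans_lt htT⟩
  by_cases hxΩ : x ∈ Ω
  · have hloc : IsLocalMax (fun y => w y t) x := by
      filter_upwards [hΩ.mem_nhds hxΩ] with y hy
      have := hmax (y, t) ⟨subset_closure hy, ht⟩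
      simp only at this
      linarith
    have hle := hcrit x hxΩ t htI hloc
    have hder : HasDerivAt (fun s => w x s - η * s) (deriv (w x) t - η) t := by
      simpa using (hdt x hxΩ t htI).hasDerivAt.fun_sub ((hasDerivAt_id' t).const_mul η)
    have hmaxt : IsLocalMaxOn (fun s => w x s - η * s) (Icc 0 t) t := by
      filter_upwards [self_mem_nhdsWithin] with s hs
      exact hmax (x, s) ⟨hx, hs.1, hs.2.trans ht.2⟩
    have hcone : (-t : ℝ) ∈ posTangentConeAt (Icc 0 t) t := by
      apply mem_posTangentConeAt_of_segment_subset
      rw [add_neg_cancel, segment_symm, segment_eq_Icc htpos.le]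
    have := hmaxt.hasFDerivWithinAt_nonpos hder.hasFDerivAt.hasFDerivWithinAt hcone
    simp only [ContinuousLinearMap.toSpanSingleton_apply, smul_eq_mul] at this
    nlinarith
  · have hfr : x ∈ frontier Ω := ⟨hx, by rwa [hΩ.interior_eq]⟩
    have := hbc x hfr t htI
    linarith

end MaximumPrinciple

namespace IsClassicalSolution

variable {d : ℕ} {Ω : Set (Fin d → ℝ)} {T ε δ : ℝ} {f : Fin d → ℝ → ℝ} {B : ℝ → ℝ}
  {u₀ : (Fin d → ℝ) → ℝ} {u : (Fin d → ℝ) → ℝ → ℝ}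

theorem hasFDerivAt_flux (h : IsClassicalSolution Ω T ε δ f B u₀ u) (hf : ∀ j, ContDiff ℝ 2 (f j))
    {x : Fin d → ℝ} (hx : x ∈ Ω) {t : ℝ} (ht : t ∈ Ioo 0 T) (j : Fin d) :
    HasFDerivAt (fun y => f j (u y t))
      (deriv (f j) (u x t) • fderiv ℝ (fun y => u y t) x) x :=
  ((hf j).differentiable two_ne_zero (u x t)).hasDerivAt.comp_hasFDerivAt x
    (h.diff_x x hx t ht).hasFDerivAt

theorem hasFDerivAt_viscous_flux (h : IsClassicalSolution Ω T ε δ f B u₀ u)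
    (hB : ContDiff ℝ 1 B) {x : Fin d → ℝ} (hx : x ∈ Ω) {t : ℝ} (ht : t ∈ Ioo 0 T) (j : Fin d) :
    HasFDerivAt (fun y => (B (u y t) + δ) * pderiv' (fun z => u z t) j y)
      ((B (u x t) + δ) • fderiv ℝ (fun y => pderiv' (fun z => u z t) j y) x +
        pderiv' (fun z => u z t) j x • deriv B (u x t) • fderiv ℝ (fun y => u y t) x) x :=
  (((hB.differentiable one_ne_zero (u x t)).hasDerivAt.comp_hasFDerivAt x
    (h.diff_x x hx t ht).hasFDerivAt).add_const δ).mul (h.diff_xx j x hx t ht).hasFDerivAt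

/-- At a spatial critical point only the pure second derivatives survive in the equation. -/
theorem deriv_eq_of_fderiv_eq_zero (h : IsClassicalSolution Ω T ε δ f B u₀ u)
    (hf : ∀ j, ContDiff ℝ 2 (f j)) (hB : ContDiff ℝ 1 B) {x : Fin d → ℝ} (hx : x ∈ Ω) {t : ℝ}
    (ht : t ∈ Ioo 0 T) (h0 : fderiv ℝ (fun y => u y t) x = 0) :
    deriv (u x) t = ε * ((B (u x t) + δ) *
      ∑ j, pderiv' (pderiv' (fun y => u y t) j) j x) := by
  have h1 := h.pde x hx t ht
  have h2 : ∀ j, pderiv' (fun y => f j (u y t)) j x = 0 := fun j => by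
    rw [pderiv', (h.hasFDerivAt_flux hf hx ht j).fderiv, h0]
    simp
  have h3 : ∀ j, pderiv' (fun y => (B (u y t) + δ) * pderiv' (fun z => u z t) j y) j x
      = (B (u x t) + δ) * pderiv' (pderiv' (fun y => u y t) j) j x := fun j => by
    rw [pderiv', (h.hasFDerivAt_viscous_flux hB hx ht j).fderiv, h0]
    simp only [smul_zero, add_zero]
    rfl
  simpa [h2, h3, Finset.mul_sum] using h1

theorem abs_le (h : IsClassicalSolution Ω T ε δ f B u₀ u) (hΩ : IsOpen Ω)
    (hΩbd : Bornology.IsBounded Ω) (hε : 0 < ε) (hδ : 0 < δ) (hf : ∀ j, ContDiff ℝ 2 (f j))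
    (hB : ContDiff ℝ 1 B) (hB0 : ∀ y, 0 ≤ B y) {A : ℝ} (hA : 0 ≤ A) (hu₀ : ∀ x, |u₀ x| ≤ A)
    {x : Fin d → ℝ} (hx : x ∈ Ω) {t : ℝ} (ht : t ∈ Ioo 0 T) : |u x t| ≤ A := by
  have hd : ∀ x ∈ Ω, ∀ t ∈ Ioo 0 T, ∀ᶠ y in 𝓝 x, DifferentiableAt ℝ (fun z => u z t) y :=
    fun x hx t ht => by
      filter_upwards [hΩ.mem_nhds hx] with y hy using h.diff_x y hy t ht
  have hpos : ∀ y, 0 ≤ B y + δ := fun y => add_nonneg (hB0 y) hδ.le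
  refine abs_le'.2 ⟨?_, ?_⟩
  · refine le_of_deriv_nonpos_of_isLocalMax hΩ hΩbd h.cont h.diff_t ?_
      (fun x hx t ht => (h.bc x hx t ht).trans_le hA)
      (fun x hx => (h.ic x hx).trans_le (_root_.abs_le.1 (hu₀ x)).2) hx ht
    intro x hx t ht hmax
    rw [h.deriv_eq_of_fderiv_eq_zero hf hB hx ht hmax.fderiv_eq_zero]
    exact mul_nonpos_of_nonneg_of_nonpos hε.le <| mul_nonpos_of_nonneg_of_nonpos (hpos _) <|
      Finset.sum_nonpos fun j _ =>
        hmax.pderiv'_pderiv'_nonpos (hd x hx t ht) j (h.diff_xx j x hx t ht)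
  · refine le_of_deriv_nonpos_of_isLocalMax (w := fun x t => -u x t) hΩ hΩbd h.cont.neg
      (fun x hx t ht => (h.diff_t x hx t ht).neg) ?_
      (fun x hx t ht => by simpa [h.bc x hx t ht] using hA)
      (fun x hx => by
        rw [h.ic x hx]
        exact (neg_le_abs _).trans (hu₀ x)) hx ht
    intro x hx t ht hmax
    have hmin : IsLocalMin (fun y => u y t) x := by simpa using hmax.neg
    have hneg : ∀ j, pderiv' (fun y => -u y t) j = fun y => -pderiv' (fun y => u y t) j y :=
      fun j => by
        ext y
        simp [pderiv', fderiv_fun_neg]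
    have hle : ∀ j, 0 ≤ pderiv' (pderiv' (fun y => u y t) j) j x := fun j => by
      have := hmax.pderiv'_pderiv'_nonpos
        ((hd x hx t ht).mono fun y hy => hy.neg) j
        (by rw [hneg]; exact (h.diff_xx j x hx t ht).neg)
      rw [hneg, pderiv', fderiv_fun_neg] at this
      simpa [pderiv'] using this
    rw [deriv.fun_neg, h.deriv_eq_of_fderiv_eq_zero hf hB hx ht hmin.fderiv_eq_zero,
      neg_nonpos]
    exact mul_nonneg hε.le (mul_nonneg (hpos _) (Finset.sum_nonneg fun j _ => hle j))

theorem continuousOn_interior (h : IsClassicalSolution Ω T ε δ f B u₀ u) :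
    ContinuousOn (fun p : (Fin d → ℝ) × ℝ => u p.1 p.2) (Ω ×ˢ Ioo 0 T) :=
  h.cont.mono (prod_mono subset_closure Ioo_subset_Icc_self)

end IsClassicalSolution

/-- A spatial Fréchet derivative of a slice gives a line derivative in space-time. -/
theorem HasFDerivAt.hasLineDerivAt_slice {d : ℕ} {w : (Fin d → ℝ) → ℝ → ℝ}
    {p : (Fin d → ℝ) × ℝ} {w' : (Fin d → ℝ) →L[ℝ] ℝ}
    (h : HasFDerivAt (fun y => w y p.2) w' p.1) (e : Fin d → ℝ) :
    HasLineDerivAt ℝ (fun q : (Fin d → ℝ) × ℝ => w q.1 q.2) (w' e) p (e, 0) := by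
  simpa [HasLineDerivAt] using h.hasLineDerivAt e

/-- A time derivative of a slice gives a line derivative in space-time. -/
theorem HasDerivAt.hasLineDerivAt_slice {d : ℕ} {w : (Fin d → ℝ) → ℝ → ℝ}
    {p : (Fin d → ℝ) × ℝ} {w' : ℝ} (h : HasDerivAt (w p.1) w' p.2) :
    HasLineDerivAt ℝ (fun q : (Fin d → ℝ) × ℝ => w q.1 q.2) w' p (0, 1) := by
  simpa [HasLineDerivAt] using h.hasFDerivAt.hasLineDerivAt 1

namespace IsClassicalSolution

variable {d : ℕ} {Ω : Set (Fin d → ℝ)} {T ε δ : ℝ} {f : Fin d → ℝ → ℝ} {B : ℝ → ℝ}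
  {u₀ : (Fin d → ℝ) → ℝ} {u : (Fin d → ℝ) → ℝ → ℝ} {v : (Fin d → ℝ) × ℝ → ℝ}

/-- The gradient of a classical solution can be moved onto a test function. -/
theorem integral_pderiv'_mul (h : IsClassicalSolution Ω T ε δ f B u₀ u) (hΩ : IsOpen Ω)
    (hv : ContDiff ℝ 1 v) (hvc : HasCompactSupport v) (hvS : tsupport v ⊆ Ω ×ˢ Ioo 0 T)
    (j : Fin d) :
    ∫ q in Ω ×ˢ Ioo 0 T, pderiv' (fun y => u y q.2) j q.1 * v q
      = -∫ q in Ω ×ˢ Ioo 0 T, u q.1 q.2 * fderiv ℝ v q (Pi.single j 1, 0) := by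
  have hS : IsOpen (Ω ×ˢ Ioo 0 T) := hΩ.prod isOpen_Ioo
  have hline : ∀ p ∈ Ω ×ˢ Ioo 0 T, HasLineDerivAt ℝ
      (fun q : (Fin d → ℝ) × ℝ => u q.1 q.2) (pderiv' (fun y => u y p.2) j p.1) p
      (Pi.single j 1, 0) := fun p hp =>
    (h.diff_x p.1 hp.1 p.2 hp.2).hasFDerivAt.hasLineDerivAt_slice _
  rw [setIntegral_mul_fderiv_eq_neg_of_hasLineDerivAt hS h.continuousOn_interior (h.cont_dx j)
    hline hv hvc hvS, neg_neg]

/-- The weak formulation satisfied by a classical solution. -/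
theorem weak_formulation (h : IsClassicalSolution Ω T ε δ f B u₀ u) (hΩ : IsOpen Ω)
    (hf : ∀ j, ContDiff ℝ 2 (f j)) (hB : ContDiff ℝ 1 B)
    (hv : ContDiff ℝ 1 v) (hvc : HasCompactSupport v) (hvS : tsupport v ⊆ Ω ×ˢ Ioo 0 T) :
    (∫ q in Ω ×ˢ Ioo 0 T, u q.1 q.2 * fderiv ℝ v q (0, 1)) +
      (∑ j, ∫ q in Ω ×ˢ Ioo 0 T, f j (u q.1 q.2) * fderiv ℝ v q (Pi.single j 1, 0))
      = ε * ∑ j, ∫ q in Ω ×ˢ Ioo 0 T, ((B (u q.1 q.2) + δ) * pderiv' (fun y => u y q.2) j q.1) *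
          fderiv ℝ v q (Pi.single j 1, 0) := by
  have hS : IsOpen (Ω ×ˢ Ioo 0 T) := hΩ.prod isOpen_Ioo
  have hu := h.continuousOn_interior
  have hFc : ∀ j, ContinuousOn (fun p : (Fin d → ℝ) × ℝ => pderiv' (fun y => f j (u y p.2)) j p.1)
      (Ω ×ˢ Ioo 0 T) := fun j => by
    refine ContinuousOn.congr (f := fun p : (Fin d → ℝ) × ℝ =>
      deriv (f j) (u p.1 p.2) * pderiv' (fun y => u y p.2) j p.1) ?_ fun p hp => ?_
    · exact (((hf j).continuous_deriv one_le_two).comp_continuousOn hu).mul (h.cont_dx j)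
    · rw [pderiv', (h.hasFDerivAt_flux hf hp.1 hp.2 j).fderiv]
      rfl
  have hGc : ∀ j, ContinuousOn (fun p : (Fin d → ℝ) × ℝ =>
      pderiv' (fun y => (B (u y p.2) + δ) * pderiv' (fun z => u z p.2) j y) j p.1)
      (Ω ×ˢ Ioo 0 T) := fun j => by
    refine ContinuousOn.congr (f := fun p : (Fin d → ℝ) × ℝ =>
      (B (u p.1 p.2) + δ) * pderiv' (pderiv' (fun y => u y p.2) j) j p.1 +
        pderiv' (fun y => u y p.2) j p.1 *
          (deriv B (u p.1 p.2) * pderiv' (fun y => u y p.2) j p.1)) ?_ fun p hp => ?_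
    · exact (((hB.continuous.comp_continuousOn hu).add continuousOn_const).mul
        (h.cont_dxx j j)).add ((h.cont_dx j).mul
          (((hB.continuous_deriv le_rfl).comp_continuousOn hu).mul (h.cont_dx j)))
    · rw [pderiv', (h.hasFDerivAt_viscous_flux hB hp.1 hp.2 j).fderiv]
      rfl
  have ht := setIntegral_mul_fderiv_eq_neg_of_hasLineDerivAt (μ := volume) hS hu h.cont_dt
    (fun p hp => (h.diff_t p.1 hp.1 p.2 hp.2).hasDerivAt.hasLineDerivAt_slice) hv hvc hvS
  have hF : ∀ j, _ := fun j => setIntegral_mul_fderiv_eq_neg_of_hasLineDerivAt (μ := volume)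
    (e := ((Pi.single j 1, 0) : (Fin d → ℝ) × ℝ)) hS
    ((hf j).continuous.comp_continuousOn hu) (hFc j)
    (fun p hp => (h.hasFDerivAt_flux hf hp.1 hp.2 j).differentiableAt.hasFDerivAt.hasLineDerivAt_slice
      (w := fun y t => f j (u y t)) _) hv hvc hvS
  have hG : ∀ j, _ := fun j => setIntegral_mul_fderiv_eq_neg_of_hasLineDerivAt (μ := volume)
    (e := ((Pi.single j 1, 0) : (Fin d → ℝ) × ℝ)) hS
    (((hB.continuous.comp_continuousOn hu).add continuousOn_const).mul (h.cont_dx j)) (hGc j)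
    (fun p hp =>
      (h.hasFDerivAt_viscous_flux hB hp.1 hp.2 j).differentiableAt.hasFDerivAt.hasLineDerivAt_slice
        (w := fun y t => (B (u y t) + δ) * pderiv' (fun z => u z t) j y) _) hv hvc hvS
  have hint : ∀ {F : (Fin d → ℝ) × ℝ → ℝ}, ContinuousOn F (Ω ×ˢ Ioo 0 T) →
      Integrable (fun q => F q * v q) (volume.restrict (Ω ×ˢ Ioo 0 T)) := fun hF =>
    (integrable_mul_of_tsupport_subset (μ := volume) hS hF hv.continuous hvc hvS).integrableOn
  refine (congrArg₂ (· + ·) ht (Finset.sum_congr rfl fun j _ => hF j)).trans ?_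
  refine Eq.trans ?_ (congrArg (ε * ·) (Finset.sum_congr rfl fun j _ => hG j)).symm
  simp only [Finset.sum_neg_distrib, mul_neg, ← neg_add]
  rw [← integral_finsetSum _ fun j _ => hint (hFc j),
    ← integral_finsetSum _ fun j _ => hint (hGc j),
    ← integral_add (hint h.cont_dt) (integrable_finsetSum _ fun j _ => hint (hFc j)),
    ← integral_const_mul]
  congr 1
  refine setIntegral_congr_fun hS.measurableSet fun p hp => ?_
  simp only [← Finset.sum_mul]
  rw [← add_mul, h.pde p.1 hp.1 p.2 hp.2, mul_assoc]

end IsClassicalSolution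

/-- **The limiting weak formulation in `δ`**: if classical solutions `uₙ` of the problems
with viscosities `B + δₙ` (`δₙ → 0`) converge a.e. on `Ω_T` to `u`, then for every test
function `v ∈ C_c^∞(Ω_T)` the limit
`L(v) = limₙ Σⱼ ∫_{Ω_T} B(uₙ) ∂ⱼuₙ ∂ⱼv` exists and
`∫_{Ω_T} u ∂ₜv + Σⱼ ∫_{Ω_T} fⱼ(u) ∂ⱼv = ε L(v)`. -/
theorem limit_weak_formulation
    (d : ℕ) (Ω : Set (Fin d → ℝ)) (hΩopen : IsOpen Ω) (hΩbd : Bornology.IsBounded Ω)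
    (T ε A : ℝ) (hT : 0 < T) (hε : 0 < ε) (hA : 0 < A)
    (f : Fin d → ℝ → ℝ) (hf : ∀ j, ContDiff ℝ 2 (f j))
    (hf' : ∀ j, ∃ C, ∀ y : ℝ, |deriv (f j) y| ≤ C)
    (B : ℝ → ℝ) (hB : ContDiff ℝ 1 B) (hBbd : ∃ C, ∀ y : ℝ, |B y| ≤ C)
    (hBnonneg : ∀ y : ℝ, 0 ≤ B y)
    (δ : ℕ → ℝ) (hδpos : ∀ n, 0 < δ n)
    (hδ0 : Filter.Tendsto δ Filter.atTop (nhds 0))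
    (u₀ : ℕ → (Fin d → ℝ) → ℝ) (hu₀smooth : ∀ n, ContDiff ℝ (⊤ : ℕ∞) (u₀ n))
    (hu₀supp : ∀ n, HasCompactSupport (u₀ n)) (hu₀Ω : ∀ n, tsupport (u₀ n) ⊆ Ω)
    (hu₀A : ∀ n, ∀ x, |u₀ n x| ≤ A)
    (useq : ℕ → (Fin d → ℝ) → ℝ → ℝ)
    (hu : ∀ n, IsClassicalSolution Ω T ε (δ n) f B (u₀ n) (useq n))
    (u : (Fin d → ℝ) → ℝ → ℝ)
    (hae : ∀ᵐ q ∂(volume.restrict (Ω ×ˢ Set.Ioo 0 T)),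
      Filter.Tendsto (fun n => useq n q.1 q.2) Filter.atTop (nhds (u q.1 q.2))) :
    ∀ v : (Fin d → ℝ) × ℝ → ℝ, ContDiff ℝ (⊤ : ℕ∞) v → HasCompactSupport v →
      tsupport v ⊆ Ω ×ˢ Set.Ioo 0 T →
      ∃ L : ℝ,
        Filter.Tendsto
          (fun n => ∑ j, ∫ q in Ω ×ˢ Set.Ioo 0 T,
            B (useq n q.1 q.2) * pderiv' (fun y => useq n y q.2) j q.1 *
              fderiv ℝ v q (Pi.single j 1, 0))
          Filter.atTop (nhds L) ∧
        (∫ q in Ω ×ˢ Set.Ioo 0 T, u q.1 q.2 * fderiv ℝ v q (0, 1)) +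
          (∑ j, ∫ q in Ω ×ˢ Set.Ioo 0 T, f j (u q.1 q.2) * fderiv ℝ v q (Pi.single j 1, 0))
          = ε * L := by
  intro v hv hvc hvS
  have hS : IsOpen (Ω ×ˢ Ioo 0 T) := hΩopen.prod isOpen_Ioo
  have hv1 : ContDiff ℝ 1 v := hv.of_le (by exact_mod_cast le_top)
  have hvd : ∀ e, ContDiff ℝ 1 (fun q => fderiv ℝ v q e) := fun e =>
    (hv.fderiv_right (m := 1) (by norm_cast)).clm_apply contDiff_const
  have hvdd : ∀ e e', Integrable (fun q => fderiv ℝ (fun q => fderiv ℝ v q e) q e')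
      (volume.restrict (Ω ×ˢ Ioo 0 T)) := fun e e' =>
    ((((hvd e).continuous_fderiv one_ne_zero).clm_apply
      continuous_const).integrable_of_hasCompactSupport
        ((hvc.fderiv_apply ℝ e).fderiv_apply ℝ e')).integrableOn
  have hvdi : ∀ e, Integrable (fun q => fderiv ℝ v q e) (volume.restrict (Ω ×ˢ Ioo 0 T)) :=
    fun e => ((hvd e).continuous.integrable_of_hasCompactSupport
      (hvc.fderiv_apply ℝ e)).integrableOn
  have hbd : ∀ n, ∀ q ∈ Ω ×ˢ Ioo 0 T, |useq n q.1 q.2| ≤ A := fun n q hq =>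
    (hu n).abs_le hΩopen hΩbd hε (hδpos n) hf hB hBnonneg hA.le (hu₀A n) hq.1 hq.2
  have hlim : ∀ (g : ℝ → ℝ), Continuous g → ∀ e, Tendsto
      (fun n => ∫ q in Ω ×ˢ Ioo 0 T, g (useq n q.1 q.2) * fderiv ℝ v q e) atTop
      (𝓝 (∫ q in Ω ×ˢ Ioo 0 T, g (u q.1 q.2) * fderiv ℝ v q e)) := by
    intro g hg e
    obtain ⟨C, hC⟩ := (isCompact_Icc (a := -A) (b := A)).exists_bound_of_continuousOn
      hg.continuousOn
    refine tendsto_integral_of_dominated_convergence (fun q => C * ‖fderiv ℝ v q e‖)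
      (fun n => ?_) ((hvdi e).norm.const_mul C) (fun n => ?_) ?_
    · exact ((hg.comp_continuousOn (hu n).continuousOn_interior).mul
        (hvd e).continuous.continuousOn).aestronglyMeasurable hS.measurableSet
    · filter_upwards [ae_restrict_mem hS.measurableSet] with q hq
      rw [norm_mul]
      exact mul_le_mul_of_nonneg_right (hC _ (abs_le.1 (hbd n q hq))) (norm_nonneg _)
    · filter_upwards [hae] with q hq
      exact ((hg.tendsto _).comp hq).mul_const _
  have hLHS := (hlim id continuous_id (0, 1)).add
    (tendsto_finsetSum Finset.univ fun j _ =>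
      hlim (f j) (hf j).continuous ((Pi.single j 1, 0) : (Fin d → ℝ) × ℝ))
  have hsmall : Tendsto (fun n => δ n * ∑ j, ∫ q in Ω ×ˢ Ioo 0 T,
      pderiv' (fun y => useq n y q.2) j q.1 * fderiv ℝ v q (Pi.single j 1, 0)) atTop (𝓝 0) := by
    refine hδ0.zero_mul_isBoundedUnder_le (isBoundedUnder_of ⟨∑ j : Fin d, A * ∫ q in Ω ×ˢ Ioo 0 T,
      ‖fderiv ℝ (fun q => fderiv ℝ v q (Pi.single j 1, 0)) q (Pi.single j 1, 0)‖, fun n => ?_⟩)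
    refine (norm_sum_le _ _).trans (Finset.sum_le_sum fun j _ => ?_)
    rw [(hu n).integral_pderiv'_mul hΩopen (hvd _) (hvc.fderiv_apply ℝ _)
      (tsupport_fderiv_apply_subset_of_subset hvS _), norm_neg, ← integral_const_mul]
    refine norm_integral_le_of_norm_le ((hvdd _ _).norm.const_mul A) ?_
    filter_upwards [ae_restrict_mem hS.measurableSet] with q hq
    rw [norm_mul]
    exact mul_le_mul_of_nonneg_right (hbd n q hq) (norm_nonneg _)
  have hweak : ∀ n, ∑ j, ∫ q in Ω ×ˢ Ioo 0 T,
        B (useq n q.1 q.2) * pderiv' (fun y => useq n y q.2) j q.1 *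
          fderiv ℝ v q (Pi.single j 1, 0)
      = ε⁻¹ * ((∫ q in Ω ×ˢ Ioo 0 T, useq n q.1 q.2 * fderiv ℝ v q (0, 1)) +
          ∑ j, ∫ q in Ω ×ˢ Ioo 0 T, f j (useq n q.1 q.2) * fderiv ℝ v q (Pi.single j 1, 0))
        - δ n * ∑ j, ∫ q in Ω ×ˢ Ioo 0 T,
            pderiv' (fun y => useq n y q.2) j q.1 * fderiv ℝ v q (Pi.single j 1, 0) := by
    intro n
    rw [(hu n).weak_formulation hΩopen hf hB hv1 hvc hvS, inv_mul_cancel_left₀ hε.ne',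
      Finset.mul_sum, ← Finset.sum_sub_distrib]
    refine Finset.sum_congr rfl fun j _ => ?_
    have hint : ∀ {F : (Fin d → ℝ) × ℝ → ℝ}, ContinuousOn F (Ω ×ˢ Ioo 0 T) →
        Integrable (fun q => F q * fderiv ℝ v q (Pi.single j 1, 0))
          (volume.restrict (Ω ×ˢ Ioo 0 T)) := fun hF =>
      (integrable_mul_of_tsupport_subset (μ := volume) hS hF (hvd _).continuous
        (hvc.fderiv_apply ℝ _) (tsupport_fderiv_apply_subset_of_subset hvS _)).integrableOn
    have hBu : ContinuousOn (fun q : (Fin d → ℝ) × ℝ => B (useq n q.1 q.2) *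
        pderiv' (fun y => useq n y q.2) j q.1) (Ω ×ˢ Ioo 0 T) :=
      (hB.continuous.comp_continuousOn (hu n).continuousOn_interior).mul ((hu n).cont_dx j)
    rw [eq_sub_iff_add_eq, ← integral_const_mul, ← integral_add (hint hBu)
      ((hint ((hu n).cont_dx j)).const_mul _)]
    exact integral_congr_ae (Eventually.of_forall fun q => by ring)
  refine ⟨ε⁻¹ * ((∫ q in Ω ×ˢ Ioo 0 T, u q.1 q.2 * fderiv ℝ v q (0, 1)) +
    ∑ j, ∫ q in Ω ×ˢ Ioo 0 T, f j (u q.1 q.2) * fderiv ℝ v q (Pi.single j 1, 0)), ?_,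
    (mul_inv_cancel_left₀ hε.ne' _).symm⟩
  simp only [hweak]
  simpa using (hLHS.const_mul ε⁻¹).sub hsmall
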